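/- arXiv:1708.06584 — 2 statements merged into one kernel-verified Lean document; each statement's English description precedes it below -/
import Mathlib

section
/- Let t be a bounded transfinite sequence of reals of nonzero length, let A be a subset of the ordinals below ℓ(t), let α be the order type of A and β the order type of its complement in ℓ(t), and let s be the transfinite sequence of reals of length α obtained by reindexing the restriction of t to A along the order isomorphism of α with A. If β + α = α, then M̄(s) = M̄(t); if additionally ℓ(t) is indecomposable, then ℓ(s) = ℓ(t). -/
open Ordinal

/-- The number `n` of full blocks in the standard decomposition `o = ω^σ·n + ρ`,
where `ω^σ = ω ^ log ω o` is the largest indecomposable ordinal `≤ o`. -/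
noncomputable def stdBlocks (o : Ordinal.{0}) : ℕ :=
  Cardinal.toNat (o / omega0 ^ log omega0 o).card

/-- The upper mean `M̄` of a transfinite sequence of reals.  A sequence of length `o`
is encoded as a total function `f : Ordinal → ℝ`; only the values of `f` at ordinals
`< o` are ever used.  It is defined by transfinite recursion on `o`:
(1) for `o = 1` it is `f 0`;
(2) for `o` indecomposable with `o > 1` (i.e. `o = ω^σ` with `σ > 0`) it is
    `limsup_{ξ → o} M̄(f|_ξ) = inf_{1 ≤ ζ < o} sup_{ζ ≤ ξ < o} M̄(f|_ξ)`;
(3) for decomposable `o`, writing `o = ω^σ·n + ρ` with `ρ < ω^σ`, it is the average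
    `(1/n) (M̄(s₀) + ⋯ + M̄(s_{n-1}))` of the upper means of the `n` consecutive
    blocks of `f` of length `ω^σ` (the remainder of length `ρ` is discarded). -/
noncomputable def upperMean (o : Ordinal.{0}) (f : Ordinal.{0} → ℝ) : ℝ :=
  if o = 1 then f 0
  else if h1 : 1 < o ∧ o = omega0 ^ log omega0 o then
    ⨅ ζ : Set.Ico (1 : Ordinal.{0}) o, ⨆ ξ : Set.Ico ζ.1 o, upperMean ξ.1 f
  else if h2 : 1 < o then
    ((stdBlocks o : ℝ))⁻¹ *
      ∑ i ∈ Finset.range (stdBlocks o),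
        upperMean (omega0 ^ log omega0 o)
          (fun ξ => f (omega0 ^ log omega0 o * (i : Ordinal) + ξ))
  else 0
termination_by o
decreasing_by
  · exact ξ.2.2
  · exact lt_of_le_of_ne (opow_log_le_self _ (zero_lt_one.trans h2).ne')
      fun h => h1 ⟨h2, h.symm⟩

/-- A transfinite sequence of reals of length `o` is bounded if its range
(on indices `< o`) is bounded in `ℝ`. -/
def SeqBounded (o : Ordinal.{0}) (f : Ordinal.{0} → ℝ) : Prop :=
  ∃ C : ℝ, ∀ ξ < o, |f ξ| ≤ C

/-- The concatenation `r ⊕ s` of a sequence `r` of length `a` with a sequence `s`: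
its first `a` entries are those of `r`, and its entry at `a + ξ'` is `s ξ'`. -/
noncomputable def concatSeq (a : Ordinal.{0}) (r s : Ordinal.{0} → ℝ) :
    Ordinal.{0} → ℝ :=
  fun ξ => if ξ < a then r ξ else s (ξ - a)

/-- An ordinal is indecomposable if it is nonzero and not the sum of two strictly
smaller ordinals. -/
def IsIndecomposable (o : Ordinal.{0}) : Prop :=
  o ≠ 0 ∧ ∀ b < o, ∀ c < o, b + c ≠ o

/-- The concatenation `s₀ ⊕ s₁ ⊕ ⋯ ⊕ s_{n-1}` of `n` sequences, each of length `β`;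
the result has length `β * n`. -/
noncomputable def concatN (β : Ordinal.{0}) :
    (n : ℕ) → (Fin n → Ordinal.{0} → ℝ) → Ordinal.{0} → ℝ
  | 0, _ => fun _ => 0
  | n + 1, s => concatSeq (β * n) (concatN β n (fun i => s i.castSucc)) (s (Fin.last n))

/-- `s / β`: given a sequence `s` whose length is `β * α`, the sequence of length `α`
whose `ι`-th entry is the upper mean of the `ι`-th consecutive block of `s` of
length `β`. -/
noncomputable def seqDiv (s : Ordinal.{0} → ℝ) (β : Ordinal.{0}) : Ordinal.{0} → ℝ :=
  fun ι => upperMean β (fun ξ => s (β * ι + ξ))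

/-- The lower mean `𝕄̲(s) = -M̄(-s)`. -/
noncomputable def lowerMean (o : Ordinal.{0}) (s : Ordinal.{0} → ℝ) : ℝ :=
  - upperMean o (fun ξ => - s ξ)

/-- A sequence `s` of length `o` has mean `c` when its upper and lower means both
equal `c`. -/
def HasMean (o : Ordinal.{0}) (s : Ordinal.{0} → ℝ) (c : ℝ) : Prop :=
  upperMean o s = c ∧ lowerMean o s = c

/-! ### Basic properties of the upper mean -/

theorem log_opow_mul_natCast_add {τ ρ : Ordinal.{0}} {n : ℕ} (hn : n ≠ 0) (hρ : ρ < ω ^ τ) :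
    log ω (ω ^ τ * n + ρ) = τ := by
  rw [log_opow_mul_add one_lt_omega0 (by exact_mod_cast hn) hρ,
    log_eq_zero (natCast_lt_omega0 n), add_zero]

theorem stdBlocks_mul_add {τ ρ : Ordinal.{0}} {n : ℕ} (hn : n ≠ 0) (hρ : ρ < ω ^ τ) :
    stdBlocks (ω ^ τ * n + ρ) = n := by
  have hlog : log ω (ω ^ τ * n + ρ) = τ :=
    log_opow_mul_natCast_add hn hρ
  rw [stdBlocks, hlog, mul_add_div _ (opow_pos τ omega0_pos).ne', div_eq_zero_of_lt hρ, add_zero,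
    card_nat, Cardinal.toNat_natCast]

theorem exists_eq_opow_mul_add {o : Ordinal.{0}} {τ : Ordinal.{0}} (ho : o < ω ^ τ * ω) :
    ∃ (n : ℕ) (ρ : Ordinal.{0}), ρ < ω ^ τ ∧ o = ω ^ τ * n + ρ := by
  have hV : ω ^ τ ≠ 0 := (opow_pos τ omega0_pos).ne'
  obtain ⟨n, hn⟩ := lt_omega0.1 ((lt_mul_iff_div_lt hV).1 ho)
  exact ⟨n, o % ω ^ τ, mod_lt _ hV, by rw [← hn, div_add_mod]⟩

theorem exists_eq_opow_log_mul_add {o : Ordinal.{0}} (ho : o ≠ 0) :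
    ∃ (n : ℕ) (ρ : Ordinal.{0}), n ≠ 0 ∧ ρ < ω ^ log ω o ∧ o = ω ^ log ω o * n + ρ := by
  have h := lt_opow_succ_log_self one_lt_omega0 o
  rw [opow_succ] at h
  obtain ⟨n, ρ, hρ, hn⟩ := exists_eq_opow_mul_add h
  refine ⟨n, ρ, ?_, hρ, hn⟩
  rintro rfl
  have := opow_log_le_self ω ho
  rw [Nat.cast_zero, mul_zero, zero_add] at hn
  exact absurd (hn ▸ hρ) (not_lt.2 this)

theorem upperMean_mul_add {τ ρ : Ordinal.{0}} {n : ℕ} (hn : n ≠ 0) (hρ : ρ < ω ^ τ)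
    (f : Ordinal.{0} → ℝ) :
    upperMean (ω ^ τ * n + ρ) f =
      (n : ℝ)⁻¹ * ∑ i ∈ Finset.range n, upperMean (ω ^ τ) (fun ξ => f (ω ^ τ * i + ξ)) := by
  have hn' : (n : Ordinal.{0}) ≠ 0 := by exact_mod_cast hn
  have hlog : log ω (ω ^ τ * n + ρ) = τ :=
    log_opow_mul_natCast_add hn hρ
  have hstd := stdBlocks_mul_add hn hρ
  by_cases h : ω ^ τ * n + ρ = ω ^ τ
  · have h1 : n = 1 := by
      rw [← hstd, h]
      simpa using stdBlocks_mul_add (τ := τ) (ρ := 0) one_ne_zero (opow_pos τ omega0_pos)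
    rw [h]
    simp [h1]
  · have hle : ω ^ τ ≤ ω ^ τ * n + ρ :=
      (le_mul_left _ (pos_iff_ne_zero.2 hn')).trans le_self_add
    have hlt : 1 < ω ^ τ * n + ρ :=
      (Order.one_le_iff_pos.2 (opow_pos τ omega0_pos)).trans_lt (lt_of_le_of_ne hle (Ne.symm h))
    rw [upperMean, if_neg hlt.ne', hlog, hstd, dif_neg fun h' => h h'.2, dif_pos hlt]

theorem upperMean_opow {σ : Ordinal.{0}} (hσ : σ ≠ 0) (f : Ordinal.{0} → ℝ) :
    upperMean (ω ^ σ) f =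
      ⨅ ζ : Set.Ico (1 : Ordinal.{0}) (ω ^ σ), ⨆ ξ : Set.Ico ζ.1 (ω ^ σ), upperMean ξ.1 f := by
  have h1 : 1 < ω ^ σ := one_lt_opow.2 ⟨one_lt_omega0, hσ⟩
  rw [upperMean, if_neg h1.ne', dif_pos ⟨h1, by rw [log_opow one_lt_omega0]⟩]

theorem upperMean_one (f : Ordinal.{0} → ℝ) : upperMean 1 f = f 0 := by
  rw [upperMean, if_pos rfl]

theorem upperMean_congr {o : Ordinal.{0}} {f g : Ordinal.{0} → ℝ} (h : ∀ ξ < o, f ξ = g ξ) :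
    upperMean o f = upperMean o g := by
  induction o using WellFoundedLT.induction generalizing f g with
  | ind o ih =>
  rcases eq_or_ne o 0 with rfl | ho
  · rw [upperMean, upperMean]; simp
  by_cases hW : o = ω ^ log ω o
  · rcases eq_or_ne (log ω o) 0 with h0 | h0
    · rw [h0, opow_zero] at hW
      rw [hW, upperMean_one, upperMean_one, h 0 (pos_iff_ne_zero.2 ho)]
    · generalize log ω o = σ at *
      subst hW
      rw [upperMean_opow h0, upperMean_opow h0]
      refine iInf_congr fun ζ => iSup_congr fun ξ => ?_
      exact ih _ ξ.2.2 fun x hx => h x (hx.trans ξ.2.2)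
  · have hlt : ω ^ log ω o < o := lt_of_le_of_ne (opow_log_le_self _ ho) (Ne.symm hW)
    obtain ⟨n, ρ, hn, hρ, hno⟩ := exists_eq_opow_log_mul_add ho
    generalize log ω o = τ at *
    subst hno
    rw [upperMean_mul_add hn hρ, upperMean_mul_add hn hρ]
    congr 1
    refine Finset.sum_congr rfl fun i hi => ih _ hlt fun x hx => h _ ?_
    have hi' : (i : Ordinal.{0}) + 1 ≤ n := by exact_mod_cast Finset.mem_range.1 hi
    calc ω ^ τ * i + x < ω ^ τ * i + ω ^ τ := by gcongr
      _ = ω ^ τ * (i + 1) := by rw [mul_add_one]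
      _ ≤ ω ^ τ * n := by gcongr
      _ ≤ _ := le_self_add

theorem abs_upperMean_le {C : ℝ} (o : Ordinal.{0}) {f : Ordinal.{0} → ℝ} (h : ∀ ξ, |f ξ| ≤ C) :
    |upperMean o f| ≤ C := by
  have hC : 0 ≤ C := (abs_nonneg _).trans (h 0)
  induction o using WellFoundedLT.induction generalizing f with
  | ind o ih =>
  rcases eq_or_ne o 0 with rfl | ho
  · rw [upperMean]; simpa using hC
  by_cases hW : o = ω ^ log ω o
  · rcases eq_or_ne (log ω o) 0 with h0 | h0
    · rw [h0, opow_zero] at hW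
      rw [hW, upperMean_one]
      exact h 0
    · generalize log ω o = σ at *
      subst hW
      have h1 : 1 < ω ^ σ := one_lt_opow.2 ⟨one_lt_omega0, h0⟩
      rw [upperMean_opow h0]
      have hlow : ∀ ζ : Set.Ico (1 : Ordinal.{0}) (ω ^ σ),
          -C ≤ ⨆ ξ : Set.Ico ζ.1 (ω ^ σ), upperMean ξ.1 f := fun ζ =>
        le_ciSup_of_le ⟨C, by rintro _ ⟨ξ, rfl⟩; exact (abs_le.1 (ih _ ξ.2.2 h)).2⟩
          ⟨ζ.1, le_rfl, ζ.2.2⟩ (abs_le.1 (ih _ ζ.2.2 h)).1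
      have : Nonempty (Set.Ico (1 : Ordinal.{0}) (ω ^ σ)) := ⟨⟨1, le_rfl, h1⟩⟩
      refine abs_le.2 ⟨le_ciInf hlow, ?_⟩
      refine ciInf_le_of_le ⟨-C, by rintro _ ⟨ζ, rfl⟩; exact hlow ζ⟩ ⟨1, le_rfl, h1⟩ ?_
      exact ciSup_le fun ξ => (abs_le.1 (ih _ ξ.2.2 h)).2
  · have hlt : ω ^ log ω o < o := lt_of_le_of_ne (opow_log_le_self _ ho) (Ne.symm hW)
    obtain ⟨n, ρ, hn, hρ, hno⟩ := exists_eq_opow_log_mul_add ho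
    generalize log ω o = τ at *
    subst hno
    have hn0 : (0 : ℝ) < n := by exact_mod_cast Nat.pos_of_ne_zero hn
    rw [upperMean_mul_add hn hρ, abs_mul, abs_of_pos (inv_pos.2 hn0), inv_mul_le_iff₀ hn0]
    refine (Finset.abs_sum_le_sum_abs _ _).trans
      ((Finset.sum_le_card_nsmul _ _ C fun i _ => ih _ hlt fun x => h _).trans ?_)
    simp

theorem exists_forall_upperMean_le {σ : Ordinal.{0}} (hσ : σ ≠ 0) {f : Ordinal.{0} → ℝ} {C c : ℝ}
    (hf : ∀ ξ, |f ξ| ≤ C) (h : upperMean (ω ^ σ) f < c) :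
    ∃ ζ < ω ^ σ, ∀ ξ, ζ ≤ ξ → ξ < ω ^ σ → upperMean ξ f ≤ c := by
  rw [upperMean_opow hσ] at h
  have h1 : 1 < ω ^ σ := one_lt_opow.2 ⟨one_lt_omega0, hσ⟩
  have : Nonempty (Set.Ico (1 : Ordinal.{0}) (ω ^ σ)) := ⟨⟨1, le_rfl, h1⟩⟩
  obtain ⟨ζ, hζ⟩ := exists_lt_of_ciInf_lt h
  refine ⟨ζ, ζ.2.2, fun ξ h1 h2 => le_trans ?_ hζ.le⟩
  exact le_ciSup (f := fun ξ : Set.Ico ζ.1 (ω ^ σ) => upperMean ξ.1 f)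
    ⟨C, by rintro _ ⟨ξ, rfl⟩; exact (abs_le.1 (abs_upperMean_le _ hf)).2⟩ ⟨ξ, h1, h2⟩

theorem upperMean_opow_le {σ : Ordinal.{0}} (hσ : σ ≠ 0) {f : Ordinal.{0} → ℝ} {C c : ℝ}
    (hf : ∀ ξ, |f ξ| ≤ C) {ζ : Ordinal.{0}} (hζ : ζ < ω ^ σ)
    (h : ∀ ξ, ζ ≤ ξ → ξ < ω ^ σ → upperMean ξ f ≤ c) : upperMean (ω ^ σ) f ≤ c := by
  have h1 : 1 < ω ^ σ := one_lt_opow.2 ⟨one_lt_omega0, hσ⟩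
  rw [upperMean_opow hσ]
  refine ciInf_le_of_le ⟨-C, ?_⟩ ⟨max 1 ζ, le_max_left _ _, max_lt h1 hζ⟩ ?_
  · rintro _ ⟨ζ, rfl⟩
    exact le_ciSup_of_le ⟨C, by rintro _ ⟨ξ, rfl⟩; exact (abs_le.1 (abs_upperMean_le _ hf)).2⟩
      ⟨ζ.1, le_rfl, ζ.2.2⟩ (abs_le.1 (abs_upperMean_le _ hf)).1
  · have : Nonempty (Set.Ico (max 1 ζ) (ω ^ σ)) := ⟨⟨max 1 ζ, le_rfl, max_lt h1 hζ⟩⟩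
    exact ciSup_le fun ξ => h _ ((le_max_right _ _).trans ξ.2.1) ξ.2.2

theorem upperMean_opow_le_of_eventually {σ : Ordinal.{0}} (hσ : σ ≠ 0) {f g : Ordinal.{0} → ℝ}
    {C : ℝ} (hf : ∀ ξ, |f ξ| ≤ C) (hg : ∀ ξ, |g ξ| ≤ C)
    (h : ∀ c, ∀ ζ < ω ^ σ, (∀ ξ, ζ ≤ ξ → ξ < ω ^ σ → upperMean ξ f ≤ c) → ∀ ε > 0,
      ∃ ζ' < ω ^ σ, ∀ ξ, ζ' ≤ ξ → ξ < ω ^ σ → upperMean ξ g ≤ c + ε) :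
    upperMean (ω ^ σ) g ≤ upperMean (ω ^ σ) f := by
  refine le_of_forall_pos_le_add fun ε hε => ?_
  obtain ⟨ζ, hζ, hle⟩ := exists_forall_upperMean_le hσ hf
    (lt_add_of_pos_right (upperMean (ω ^ σ) f) (half_pos hε))
  obtain ⟨ζ', hζ', hle'⟩ := h _ ζ hζ hle _ (half_pos hε)
  rw [add_assoc, add_halves] at hle'
  exact upperMean_opow_le hσ hg hζ' hle'

/-- Two bounded sequences of length `ω ^ (τ + 1)` whose blocks of length `ω ^ τ` have the same
upper means, up to deleting finitely many blocks from each, have comparable upper means. -/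
theorem upperMean_opow_add_one_le {τ : Ordinal.{0}} {f g : Ordinal.{0} → ℝ} {C : ℝ}
    (hf : ∀ ξ, |f ξ| ≤ C) (hg : ∀ ξ, |g ξ| ≤ C) (m N : ℕ)
    (h : ∀ i : ℕ, upperMean (ω ^ τ) (fun x => g (ω ^ τ * (m + i : ℕ) + x)) =
      upperMean (ω ^ τ) (fun x => f (ω ^ τ * (N + i : ℕ) + x))) :
    upperMean (ω ^ (τ + 1)) g ≤ upperMean (ω ^ (τ + 1)) f := by
  have hV : ω ^ τ ≠ 0 := (opow_pos τ omega0_pos).ne'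
  have hW : ω ^ (τ + 1) = ω ^ τ * ω := opow_add_one ω τ
  have hlt : ∀ n : ℕ, ω ^ τ * n < ω ^ (τ + 1) := fun n => by
    rw [hW]; exact mul_lt_mul_of_pos_left (natCast_lt_omega0 n) (pos_iff_ne_zero.2 hV)
  refine upperMean_opow_le_of_eventually (by simp) hf hg fun c ζ hζ hc ε hε => ?_
  set b : ℕ → ℝ := fun i => upperMean (ω ^ τ) (fun x => f (ω ^ τ * i + x)) with hb
  set b' : ℕ → ℝ := fun i => upperMean (ω ^ τ) (fun x => g (ω ^ τ * i + x)) with hb'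
  rw [hW] at hζ
  obtain ⟨k, ρ, hρ, rfl⟩ := exists_eq_opow_mul_add hζ
  have hsum : ∀ n : ℕ, k + 1 ≤ n → ∑ i ∈ Finset.range n, b i ≤ n * c := fun n hn => by
    have hn0 : (0 : ℝ) < n := by exact_mod_cast Nat.lt_of_lt_of_le k.succ_pos hn
    have h1 := hc (ω ^ τ * n + 0) ?_ (by simpa using hlt n)
    · rwa [upperMean_mul_add (by omega) (opow_pos τ omega0_pos), inv_mul_le_iff₀ hn0] at h1
    · calc ω ^ τ * k + ρ ≤ ω ^ τ * k + ω ^ τ := by gcongr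
        _ = ω ^ τ * (k + 1 : ℕ) := by push_cast; rw [mul_add_one]
        _ ≤ ω ^ τ * n + 0 := by rw [add_zero]; gcongr
  set K : ℝ := ∑ i ∈ Finset.range m, b' i - ∑ i ∈ Finset.range N, b i + N * c - m * c with hK
  obtain ⟨J, hJ⟩ := exists_nat_ge (K / ε)
  rw [div_le_iff₀ hε] at hJ
  refine ⟨ω ^ τ * (m + (J + k + 1) : ℕ), hlt _, fun ξ hξ hξ' => ?_⟩
  rw [hW] at hξ'
  obtain ⟨n, ρ', hρ', rfl⟩ := exists_eq_opow_mul_add hξ'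
  have hn : m + (J + k + 1) ≤ n := by
    have h2 : ω ^ τ * (m + (J + k + 1) : ℕ) < ω ^ τ * (n + 1 : ℕ) := by
      refine hξ.trans_lt ?_
      push_cast
      rw [mul_add_one]
      gcongr
    have h3 := lt_of_mul_lt_mul_left h2 zero_le
    exact Nat.lt_succ_iff.1 (by exact_mod_cast h3)
  obtain ⟨j, rfl⟩ := Nat.exists_eq_add_of_le ((Nat.le_add_right m _).trans hn)
  have hm0 : (0 : ℝ) < ((m + j : ℕ) : ℝ) := by exact_mod_cast (by omega : 0 < m + j)
  rw [upperMean_mul_add (by omega) hρ', inv_mul_le_iff₀ hm0]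
  have e1 : ∑ i ∈ Finset.range (m + j), b' i =
      ∑ i ∈ Finset.range m, b' i + ∑ i ∈ Finset.range j, b (N + i) := by
    rw [Finset.sum_range_add]
    congr 1
    exact Finset.sum_congr rfl fun i _ => h i
  have e2 := Finset.sum_range_add b N j
  have e3 := hsum (N + j) (by omega)
  have e4 : (J : ℝ) * ε ≤ ((m + j : ℕ) : ℝ) * ε := by
    gcongr
    omega
  change ∑ i ∈ Finset.range (m + j), b' i ≤ _
  push_cast at *
  nlinarith

/-! ### Splitting the ordinals into two sets -/

/-- The order type of the part of the range of `e` lying below `ξ`, for strictly monotone `e`. -/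
noncomputable def countBelow (e : Ordinal.{0} → Ordinal.{0}) (ξ : Ordinal.{0}) : Ordinal.{0} :=
  sInf {x | ξ ≤ e x}

/-- The enumeration, relative to `a`, of the part of the range of `e` lying above `a`. -/
noncomputable def shiftEnum (e : Ordinal.{0} → Ordinal.{0}) (a : Ordinal.{0}) :
    Ordinal.{0} → Ordinal.{0} :=
  fun x => e (countBelow e a + x) - a

section Enumeration

variable {e : Ordinal.{0} → Ordinal.{0}}

theorem countBelow_le_iff (he : StrictMono e) {ξ x : Ordinal.{0}} :
    countBelow e ξ ≤ x ↔ ξ ≤ e x :=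
  ⟨fun h => (csInf_mem (s := {x | ξ ≤ e x}) ⟨ξ, he.le_apply⟩).trans (he.monotone h),
    fun h => csInf_le' h⟩

theorem lt_countBelow_iff (he : StrictMono e) {ξ x : Ordinal.{0}} :
    x < countBelow e ξ ↔ e x < ξ := by
  rw [← not_le, countBelow_le_iff he, not_le]

theorem le_apply_countBelow_add (he : StrictMono e) (a x : Ordinal.{0}) :
    a ≤ e (countBelow e a + x) :=
  (countBelow_le_iff he).1 le_self_add

theorem countBelow_mono (he : StrictMono e) : Monotone (countBelow e) := fun _ _ h =>
  (countBelow_le_iff he).2 (h.trans ((countBelow_le_iff he).1 le_rfl))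

theorem countBelow_le_self (he : StrictMono e) (ξ : Ordinal.{0}) : countBelow e ξ ≤ ξ :=
  (countBelow_le_iff he).2 he.le_apply

theorem countBelow_apply (he : StrictMono e) (x : Ordinal.{0}) : countBelow e (e x) = x :=
  eq_of_forall_lt_iff fun y => by rw [lt_countBelow_iff he, he.lt_iff_lt]

theorem add_shiftEnum (he : StrictMono e) (a x : Ordinal.{0}) :
    a + shiftEnum e a x = e (countBelow e a + x) :=
  Ordinal.add_sub_cancel_of_le (le_apply_countBelow_add he a x)

theorem strictMono_shiftEnum (he : StrictMono e) (a : Ordinal.{0}) :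
    StrictMono (shiftEnum e a) := fun x y h => by
  rw [← add_lt_add_iff_left a, add_shiftEnum he, add_shiftEnum he]
  exact he (by gcongr)

theorem countBelow_add (he : StrictMono e) (a b : Ordinal.{0}) :
    countBelow e (a + b) = countBelow e a + countBelow (shiftEnum e a) b := by
  have hs := strictMono_shiftEnum he a
  refine le_antisymm ?_ (le_of_forall_lt fun x hx => ?_)
  · rw [countBelow_le_iff he, ← add_shiftEnum he]
    gcongr
    exact (countBelow_le_iff hs).1 le_rfl
  · rw [lt_countBelow_iff he]
    rcases lt_or_ge x (countBelow e a) with h | h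
    · exact ((lt_countBelow_iff he).1 h).trans_le le_self_add
    · obtain ⟨y, rfl⟩ := exists_add_of_le h
      rw [← add_shiftEnum he]
      have := (lt_countBelow_iff hs).1 (lt_of_add_lt_add_left hx)
      gcongr

theorem shiftEnum_shiftEnum (he : StrictMono e) (a b : Ordinal.{0}) :
    shiftEnum (shiftEnum e a) b = shiftEnum e (a + b) := by
  funext x
  rw [shiftEnum, shiftEnum, shiftEnum, countBelow_add he, sub_sub, add_assoc]

end Enumeration

/-- The strictly monotone functions `e` and `d` enumerate two sets that cover the ordinals. -/
structure IsSplit (e d : Ordinal.{0} → Ordinal.{0}) : Prop where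
  left : StrictMono e
  right : StrictMono d
  cover : ∀ y, y ∈ Set.range e ∨ y ∈ Set.range d

namespace IsSplit

variable {e d : Ordinal.{0} → Ordinal.{0}}

theorem symm (h : IsSplit e d) : IsSplit d e := ⟨h.right, h.left, fun y => (h.cover y).symm⟩

theorem shift (h : IsSplit e d) (a : Ordinal.{0}) : IsSplit (shiftEnum e a) (shiftEnum d a) := by
  have key : ∀ {e : Ordinal.{0} → Ordinal.{0}}, StrictMono e → ∀ y, a + y ∈ Set.range e →
      y ∈ Set.range (shiftEnum e a) := by
    rintro e he y ⟨x, hx⟩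
    have : countBelow e a ≤ x := (countBelow_le_iff he).2 (hx ▸ le_self_add)
    obtain ⟨z, rfl⟩ := exists_add_of_le this
    exact ⟨z, by rw [shiftEnum, hx, Ordinal.add_sub_cancel]⟩
  exact ⟨strictMono_shiftEnum h.left a, strictMono_shiftEnum h.right a,
    fun y => (h.cover (a + y)).imp (key h.left y) (key h.right y)⟩

/-- One of the two parts of a power of `ω` has full order type. -/
theorem le_countBelow_or (σ : Ordinal.{0}) (h : IsSplit e d) :
    ω ^ σ ≤ countBelow e (ω ^ σ) ∨ ω ^ σ ≤ countBelow d (ω ^ σ) := by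
  induction σ using limitRecOn generalizing e d with
  | zero =>
    have key : ∀ {e : Ordinal.{0} → Ordinal.{0}}, StrictMono e → 0 ∈ Set.range e →
        1 ≤ countBelow e 1 := by
      rintro e he ⟨x, hx⟩
      rw [Order.one_le_iff_pos, lt_countBelow_iff he]
      exact (he.monotone zero_le).trans_lt (hx ▸ zero_lt_one)
    rw [opow_zero]
    exact (h.cover 0).imp (key h.left) (key h.right)
  | add_one τ ih =>
    have hblocks : ∀ n : ℕ, ∃ p q : ℕ, p + q = n ∧ ω ^ τ * p ≤ countBelow e (ω ^ τ * n) ∧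
        ω ^ τ * q ≤ countBelow d (ω ^ τ * n) := by
      intro n
      induction n with
      | zero => exact ⟨0, 0, by simp⟩
      | succ n ihn =>
        obtain ⟨p, q, rfl, hp, hq⟩ := ihn
        rw [Nat.cast_succ, mul_add_one, countBelow_add h.left, countBelow_add h.right]
        rcases ih (h.shift (ω ^ τ * (p + q : ℕ))) with h' | h'
        · refine ⟨p + 1, q, by omega, ?_, hq.trans le_self_add⟩
          rw [Nat.cast_succ, mul_add_one]
          exact add_le_add hp h'
        · refine ⟨p, q + 1, by omega, hp.trans le_self_add, ?_⟩
          rw [Nat.cast_succ, mul_add_one]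
          exact add_le_add hq h'
    by_contra! hc
    rw [opow_add_one] at hc
    obtain ⟨k, ρ, hρ, hk⟩ := exists_eq_opow_mul_add hc.1
    obtain ⟨l, ρ', hρ', hl⟩ := exists_eq_opow_mul_add hc.2
    obtain ⟨p, q, hpq, hp, hq⟩ := hblocks (k + l + 1)
    have hV : 0 < ω ^ τ := opow_pos τ omega0_pos
    have hle : ω ^ τ * (k + l + 1 : ℕ) ≤ ω ^ τ * ω := by
      gcongr
      exact (natCast_lt_omega0 _).le
    have key : ∀ {r k : ℕ} {ρ : Ordinal.{0}}, ρ < ω ^ τ → ω ^ τ * r ≤ ω ^ τ * k + ρ → r ≤ k := by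
      intro r k ρ hρ hr
      have : ω ^ τ * r < ω ^ τ * (k + 1 : ℕ) := by
        refine hr.trans_lt ?_
        rw [Nat.cast_succ, mul_add_one]
        gcongr
      exact Nat.lt_succ_iff.1 (by exact_mod_cast lt_of_mul_lt_mul_left this zero_le)
    have hp' := key hρ (hk ▸ hp.trans (countBelow_mono h.left hle))
    have hq' := key hρ' (hl ▸ hq.trans (countBelow_mono h.right hle))
    omega
  | limit σ hσ ih =>
    by_contra! hc
    obtain ⟨τ, hτ, hτ'⟩ := (lt_opow_of_isSuccLimit omega0_ne_zero hσ).1 (max_lt hc.1 hc.2)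
    have hle : ω ^ τ ≤ ω ^ σ := opow_le_opow_right omega0_pos hτ.le
    rcases ih τ hτ h with h' | h'
    · exact absurd (h'.trans ((countBelow_mono h.left hle).trans (le_max_left _ _))) hτ'.not_ge
    · exact absurd (h'.trans ((countBelow_mono h.right hle).trans (le_max_right _ _))) hτ'.not_ge

theorem countBelow_opow (h : IsSplit e d) {σ : Ordinal.{0}} (hd : countBelow d (ω ^ σ) < ω ^ σ) :
    countBelow e (ω ^ σ) = ω ^ σ :=
  (countBelow_le_self h.left _).antisymm ((h.le_countBelow_or σ).resolve_right hd.not_ge)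

theorem countBelow_opow_mul (h : IsSplit e d) {τ : Ordinal.{0}} {n : ℕ}
    (hd : ∀ j < n, countBelow (shiftEnum d (ω ^ τ * j)) (ω ^ τ) < ω ^ τ) :
    countBelow e (ω ^ τ * n) = ω ^ τ * n := by
  induction n with
  | zero => simpa using countBelow_le_self h.left 0
  | succ n ih =>
    rw [Nat.cast_succ, mul_add_one, countBelow_add h.left, ih fun j hj => hd j (by omega),
      (h.shift _).countBelow_opow (hd n (by omega))]

end IsSplit

/-! ### Excision -/

/-- Excision for sequences of length `ω ^ τ`. -/
def OpowExcision (τ : Ordinal.{0}) : Prop :=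
  ∀ (e d : Ordinal.{0} → Ordinal.{0}) (t : Ordinal.{0} → ℝ) (C : ℝ), IsSplit e d →
    (∀ x, |t x| ≤ C) → countBelow d (ω ^ τ) < ω ^ τ →
      upperMean (ω ^ τ) (fun x => t (e x)) = upperMean (ω ^ τ) t

section Excision

variable {e d : Ordinal.{0} → Ordinal.{0}} {t : Ordinal.{0} → ℝ} {C : ℝ} {τ : Ordinal.{0}}

theorem OpowExcision.upperMean_block (hτ : OpowExcision τ) (h : IsSplit e d)
    (ht : ∀ x, |t x| ≤ C) {a : Ordinal.{0}} (hd : countBelow (shiftEnum d a) (ω ^ τ) < ω ^ τ) :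
    upperMean (ω ^ τ) (fun x => t (e (countBelow e a + x))) =
      upperMean (ω ^ τ) (fun x => t (a + x)) := by
  simp_rw [← add_shiftEnum h.left]
  exact hτ _ _ (fun y => t (a + y)) C (h.shift a) (fun x => ht _) hd

/-- Excision for sequences whose length has leading term `ω ^ τ`, in terms of excision for their
blocks of length `ω ^ τ`. -/
theorem OpowExcision.upperMean_countBelow {o : Ordinal.{0}} (hτ : OpowExcision (log ω o))
    (h : IsSplit e d) (ht : ∀ x, |t x| ≤ C) (ho : o ≠ 0) (hd : countBelow d o < ω ^ log ω o) :
    ω ^ log ω o ≤ countBelow e o ∧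
      upperMean (countBelow e o) (fun x => t (e x)) = upperMean o t := by
  obtain ⟨n, ρ, hn, hρ, hno⟩ := exists_eq_opow_log_mul_add ho
  generalize log ω o = τ at *
  subst hno
  have hblock : ∀ j < n, countBelow (shiftEnum d (ω ^ τ * j)) (ω ^ τ) < ω ^ τ := fun j hj => by
    refine lt_of_le_of_lt ?_ hd
    have hj' : ω ^ τ * j + ω ^ τ ≤ ω ^ τ * n + ρ := by
      rw [← mul_add_one, ← Nat.cast_succ]
      refine le_trans ?_ le_self_add
      gcongr
      exact hj
    refine le_trans ?_ (countBelow_mono h.right hj')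
    rw [countBelow_add h.right]
    exact le_add_self
  have hcount : ∀ j ≤ n, countBelow e (ω ^ τ * j) = ω ^ τ * j := fun j hj =>
    h.countBelow_opow_mul fun i hi => hblock i (by omega)
  rw [countBelow_add h.left, hcount n le_rfl]
  constructor
  · refine le_trans (le_mul_left _ ?_) le_self_add
    exact_mod_cast Nat.pos_of_ne_zero hn
  · rw [upperMean_mul_add hn hρ,
      upperMean_mul_add hn ((countBelow_le_self (h.shift _).left ρ).trans_lt hρ)]
    congr 1
    refine Finset.sum_congr rfl fun i hi => ?_
    have hi := Finset.mem_range.1 hi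
    have := hτ.upperMean_block h ht (hblock i hi)
    rwa [hcount i hi.le] at this

theorem opowExcision_zero : OpowExcision 0 := by
  intro e d t C h _ hd
  have he := h.countBelow_opow hd
  rw [opow_zero] at he ⊢
  have h0 : e 0 < 1 := (lt_countBelow_iff h.left).1 (he.symm ▸ zero_lt_one)
  rw [upperMean_one, upperMean_one, Order.lt_one_iff.1 h0]

theorem opowExcision_add_one (hτ : OpowExcision τ) : OpowExcision (τ + 1) := by
  intro e d t C h ht hd
  have hW : ω ^ (τ + 1) = ω ^ τ * ω := opow_add_one ω τ
  have hV : 0 < ω ^ τ := opow_pos τ omega0_pos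
  have hlt : ∀ n : ℕ, ω ^ τ * n < ω ^ (τ + 1) := fun n => by
    rw [hW]; exact mul_lt_mul_of_pos_left (natCast_lt_omega0 n) hV
  set γ : ℕ → Ordinal.{0} := fun j => countBelow (shiftEnum d (ω ^ τ * j)) (ω ^ (τ + 1)) with hγ
  have hγsucc : ∀ j, γ j = countBelow (shiftEnum d (ω ^ τ * j)) (ω ^ τ) + γ (j + 1) := fun j => by
    have habs : ω ^ (τ + 1) = ω ^ τ + ω ^ (τ + 1) :=
      (add_omega0_opow (by simpa using hlt 1)).symm
    simp only [hγ]
    conv_lhs => rw [habs]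
    rw [countBelow_add (h.shift _).right, shiftEnum_shiftEnum h.right, Nat.cast_succ, mul_add_one]
  have hanti : Antitone γ := antitone_nat_of_succ_le fun j => (hγsucc j).symm ▸ le_add_self
  obtain ⟨N, hN⟩ : ∃ N, ∀ j, γ N ≤ γ j :=
    ⟨Function.argmin γ, fun j => not_lt.1 (Function.not_lt_argmin γ j)⟩
  have hγ0 : γ 0 = countBelow d (ω ^ (τ + 1)) := by
    have := countBelow_add h.right 0 (ω ^ (τ + 1))
    have h0 : countBelow d 0 = 0 := le_antisymm (countBelow_le_self h.right 0) zero_le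
    rw [h0, zero_add, zero_add] at this
    simp only [hγ, Nat.cast_zero, mul_zero]
    exact this.symm
  have hblock : ∀ j, N ≤ j → countBelow (shiftEnum d (ω ^ τ * j)) (ω ^ τ) < ω ^ τ := by
    intro j hj
    have heq : ∀ i, N ≤ i → γ i = γ N := fun i hi => (hanti hi).antisymm (hN i)
    have habs := hγsucc j
    rw [heq j hj, heq (j + 1) (by omega), eq_comm, add_eq_right_iff_mul_omega0_le] at habs
    by_contra! hc
    refine absurd (hanti N.zero_le) (not_le.2 ?_)
    rw [hγ0]
    refine hd.trans_le (le_trans ?_ habs)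
    rw [hW]
    gcongr
  have hcount : ∀ j : ℕ, countBelow e (ω ^ τ * (N + j : ℕ)) =
      countBelow e (ω ^ τ * N) + ω ^ τ * j := by
    intro j
    rw [Nat.cast_add, mul_add, countBelow_add h.left,
      (h.shift (ω ^ τ * N)).countBelow_opow_mul fun i _ => ?_]
    rw [shiftEnum_shiftEnum h.right, ← mul_add, ← Nat.cast_add]
    exact hblock _ (by omega)
  obtain ⟨m, ρ, hρ, hm⟩ := exists_eq_opow_mul_add
    (hW ▸ (countBelow_le_self h.left (ω ^ τ * N)).trans_lt (hlt N))
  have hcount' : ∀ i : ℕ, countBelow e (ω ^ τ * (N + 1 + i : ℕ)) = ω ^ τ * (m + 1 + i : ℕ) := by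
    intro i
    rw [add_assoc, hcount, hm, add_assoc m]
    push_cast
    rw [mul_add, mul_add, mul_add, mul_one, add_assoc, ← add_assoc ρ, add_omega0_opow hρ]
  have hmean : ∀ i : ℕ, upperMean (ω ^ τ) (fun x => t (e (ω ^ τ * (m + 1 + i : ℕ) + x))) =
      upperMean (ω ^ τ) (fun x => t (ω ^ τ * (N + 1 + i : ℕ) + x)) := by
    intro i
    rw [← hcount']
    exact hτ.upperMean_block h ht (hblock _ (by omega))
  exact (upperMean_opow_add_one_le ht (fun x => ht _) (m + 1) (N + 1) hmean).antisymm
    (upperMean_opow_add_one_le (fun x => ht _) ht (N + 1) (m + 1) fun i => (hmean i).symm)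

theorem opowExcision_of_isSuccLimit {σ : Ordinal.{0}} (hσ : Order.IsSuccLimit σ)
    (ih : ∀ τ < σ, OpowExcision τ) : OpowExcision σ := by
  intro e d t C h ht hd
  have hσ0 : σ ≠ 0 := hσ.ne_bot
  have hcount := h.countBelow_opow hd
  obtain ⟨τ, hτ, hτd⟩ := (lt_opow_of_isSuccLimit omega0_ne_zero hσ).1 hd
  have hle : ω ^ τ < ω ^ σ := (opow_lt_opow_iff_right one_lt_omega0).2 hτ
  have key : ∀ ξ, ω ^ τ ≤ ξ → ξ < ω ^ σ →
      upperMean (countBelow e ξ) (fun x => t (e x)) = upperMean ξ t := by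
    intro ξ hξ hξ'
    have hξ0 : ξ ≠ 0 := ((opow_pos τ omega0_pos).trans_le hξ).ne'
    refine ((ih _ ((lt_opow_iff_log_lt one_lt_omega0 hξ0).1 hξ')).upperMean_countBelow
      h ht hξ0 ?_).2
    refine (countBelow_mono h.right hξ'.le).trans_lt (hτd.trans_le ?_)
    exact opow_le_opow_right omega0_pos ((opow_le_iff_le_log one_lt_omega0 hξ0).1 hξ)
  apply le_antisymm
  · refine upperMean_opow_le_of_eventually hσ0 ht (fun x => ht _) fun c ζ hζ hc ε hε =>
      ⟨max ζ (ω ^ τ), max_lt hζ hle, fun ξ hξ hξ' => ?_⟩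
    have hξe : ξ ≤ e ξ := h.left.le_apply
    have heξ : e ξ < ω ^ σ := (lt_countBelow_iff h.left).1 (hcount.symm ▸ hξ')
    have := key (e ξ) (((le_max_right _ _).trans hξ).trans hξe) heξ
    rw [countBelow_apply h.left] at this
    rw [this]
    exact (hc _ (((le_max_left _ _).trans hξ).trans hξe) heξ).trans (by linarith)
  · refine upperMean_opow_le_of_eventually hσ0 (fun x => ht _) ht fun c ζ hζ hc ε hε =>
      ⟨max (e ζ) (ω ^ τ), max_lt ((lt_countBelow_iff h.left).1 (hcount.symm ▸ hζ)) hle,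
        fun ξ hξ hξ' => ?_⟩
    rw [← key ξ ((le_max_right _ _).trans hξ) hξ']
    refine (hc _ ?_ ((countBelow_le_self h.left ξ).trans_lt hξ')).trans (by linarith)
    rw [← countBelow_apply h.left ζ]
    exact countBelow_mono h.left ((le_max_left _ _).trans hξ)

theorem opowExcision (σ : Ordinal.{0}) : OpowExcision σ := by
  induction σ using limitRecOn with
  | zero => exact opowExcision_zero
  | add_one τ ih => exact opowExcision_add_one ih
  | limit σ hσ ih => exact opowExcision_of_isSuccLimit hσ ih

end Excision

/-- The extension of an increasing enumeration of length `α` of a set of ordinals below `o` by the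
ordinals from `o` on. -/
noncomputable def extendEnum {α : Ordinal.{0}} {A : Set Ordinal.{0}} (o : Ordinal.{0})
    (eA : Set.Iio α ≃o A) : Ordinal.{0} → Ordinal.{0} :=
  fun x => if h : x < α then eA ⟨x, h⟩ else o + (x - α)

section ExtendEnum

variable {α o : Ordinal.{0}} {A : Set Ordinal.{0}}

theorem extendEnum_of_lt (eA : Set.Iio α ≃o A) {x : Ordinal.{0}} (h : x < α) :
    extendEnum o eA x = eA ⟨x, h⟩ :=
  dif_pos h

theorem extendEnum_add (eA : Set.Iio α ≃o A) (x : Ordinal.{0}) :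
    extendEnum o eA (α + x) = o + x := by
  rw [extendEnum, dif_neg (not_lt.2 le_self_add), Ordinal.add_sub_cancel]

theorem strictMono_extendEnum (hA : A ⊆ Set.Iio o) (eA : Set.Iio α ≃o A) :
    StrictMono (extendEnum o eA) := fun x y hxy => by
  rcases lt_or_ge y α with hy | hy
  · rw [extendEnum_of_lt eA hy, extendEnum_of_lt eA (hxy.trans hy)]
    exact eA.strictMono (Subtype.mk_lt_mk.2 hxy)
  obtain ⟨y, rfl⟩ := exists_add_of_le hy
  rw [extendEnum_add]
  rcases lt_or_ge x α with hx | hx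
  · rw [extendEnum_of_lt eA hx]
    exact (hA (eA ⟨x, hx⟩).2).trans_le le_self_add
  · obtain ⟨x, rfl⟩ := exists_add_of_le hx
    rw [extendEnum_add]
    have := lt_of_add_lt_add_left hxy
    gcongr

theorem countBelow_extendEnum (hA : A ⊆ Set.Iio o) (eA : Set.Iio α ≃o A) :
    countBelow (extendEnum o eA) o = α := by
  have h := countBelow_apply (strictMono_extendEnum hA eA) α
  have hα : extendEnum o eA α = o := by simpa using extendEnum_add (o := o) eA 0
  rwa [hα] at h

theorem mem_range_extendEnum (eA : Set.Iio α ≃o A) {y : Ordinal.{0}} (hy : y ∈ A) :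
    y ∈ Set.range (extendEnum o eA) := by
  refine ⟨eA.symm ⟨y, hy⟩, ?_⟩
  rw [extendEnum_of_lt eA (eA.symm ⟨y, hy⟩).2]
  simp

theorem isSplit_extendEnum {β : Ordinal.{0}} (hA : A ⊆ Set.Iio o) (eA : Set.Iio α ≃o A)
    (eB : Set.Iio β ≃o ((Set.Iio o \ A : Set Ordinal.{0}))) :
    IsSplit (extendEnum o eA) (extendEnum o eB) := by
  refine ⟨strictMono_extendEnum hA eA, strictMono_extendEnum Set.sdiff_subset eB, fun y => ?_⟩
  rcases lt_or_ge y o with hy | hy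
  · by_cases hyA : y ∈ A
    · exact .inl (mem_range_extendEnum eA hyA)
    · exact .inr (mem_range_extendEnum eB ⟨hy, hyA⟩)
  · obtain ⟨y, rfl⟩ := exists_add_of_le hy
    exact .inl ⟨α + y, extendEnum_add eA y⟩

end ExtendEnum

theorem IsIndecomposable.eq_opow_log {o : Ordinal.{0}} (ho : IsIndecomposable o) :
    o = ω ^ log ω o := by
  rcases isPrincipal_add_iff_zero_or_omega0_opow.1
    (isPrincipal_add_iff_add_lt_ne_self.2 ho.2) with h | ⟨σ, rfl⟩
  · exact absurd h ho.1
  · rw [log_opow one_lt_omega0]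

/-- excision.  Let `t` be a bounded sequence of nonzero length `o`,
`A` a set of ordinals `< o` of order type `α` (witnessed by the order isomorphism
`eA : Iio α ≃o A`), whose complement in `Iio o` has order type `β` (witnessed by
`eB`), and let `s` be the reindexing of `t|_A` along `eA`.  If `β + α = α` then
`M̄(s) = M̄(t)`, and if moreover `o` is indecomposable then `α = o`. -/
theorem upperMean_excision (o : Ordinal.{0}) (ho : o ≠ 0) (t : Ordinal.{0} → ℝ)
    (ht : SeqBounded o t)
    (A : Set Ordinal.{0}) (hA : A ⊆ Set.Iio o)
    (α β : Ordinal.{0})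
    (eA : Set.Iio α ≃o A)
    (eB : Set.Iio β ≃o ((Set.Iio o \ A : Set Ordinal.{0})))
    (s : Ordinal.{0} → ℝ)
    (hst : ∀ ξ (h : ξ < α), s ξ = t (eA ⟨ξ, h⟩))
    (hβα : β + α = α) :
    upperMean α s = upperMean o t ∧ (IsIndecomposable o → α = o) := by
  have h := isSplit_extendEnum hA eA eB
  have hα := countBelow_extendEnum hA eA
  have hβ := countBelow_extendEnum Set.sdiff_subset eB
  have hαo : α ≤ o := hα ▸ countBelow_le_self h.left o
  have hlt : β < ω ^ log ω o := by
    by_contra! hc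
    refine absurd ((add_eq_right_iff_mul_omega0_le.1 hβα).trans hαo) (not_le.2 ?_)
    refine (lt_opow_succ_log_self one_lt_omega0 o).trans_le ?_
    rw [opow_succ]
    gcongr
  obtain ⟨C, hC⟩ := ht
  set t' : Ordinal.{0} → ℝ := fun x => if x < o then t x else 0 with ht'
  have htt' : ∀ x < o, t x = t' x := fun x hx => by simp [ht', hx]
  have ht'C : ∀ x, |t' x| ≤ C := fun x => by
    rcases lt_or_ge x o with hx | hx
    · rw [← htt' x hx]
      exact hC x hx
    · simpa [ht', hx.not_gt] using (abs_nonneg _).trans (hC 0 (pos_iff_ne_zero.2 ho))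
  have hst' : ∀ x < α, s x = t' (extendEnum o eA x) := fun x hx => by
    rw [hst x hx, extendEnum_of_lt eA hx]
    exact htt' _ (hA (eA ⟨x, hx⟩).2)
  obtain ⟨hle, hmean⟩ := (opowExcision (log ω o)).upperMean_countBelow h ht'C ho (hβ.symm ▸ hlt)
  rw [hα] at hle hmean
  rw [upperMean_congr hst', upperMean_congr htt']
  exact ⟨hmean, fun hi => hαo.antisymm (hi.eq_opow_log.le.trans hle)⟩
end

section
/- Let (X, Σ, m) be a probability space and let 𝒜 ⊆ Σ be a countable collection of measurable sets. Then there exists a sequence x : ℕ → X such that for every A ∈ 𝒜, the finite averages (1/n)·#{i < n : x_i ∈ A} converge to m(A) as n → ∞. -/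
open Ordinal

open MeasureTheory

/-- The strong law of large numbers for averages of a function along independent samples of `m`. -/
theorem ae_tendsto_average_infinitePi {X : Type*} [MeasurableSpace X]
    (m : Measure X) [IsProbabilityMeasure m] {f : X → ℝ}
    (hf : Measurable f) (hint : Integrable f m) :
    ∀ᵐ x ∂Measure.infinitePi (fun _ : ℕ => m),
      Filter.Tendsto (fun n : ℕ => (n : ℝ)⁻¹ * ∑ i ∈ Finset.range n, f (x i))
        Filter.atTop (nhds (∫ a, f a ∂m)) := by
  have heval (i : ℕ) := measurePreserving_eval_infinitePi (fun _ : ℕ => m) i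
  have hindep := ProbabilityTheory.iIndepFun_infinitePi (P := fun _ : ℕ => m)
    (X := fun _ : ℕ => f) fun _ => hf
  have hident (i : ℕ) : ProbabilityTheory.IdentDistrib (fun x : ℕ → X => x i)
      (fun x => x 0) (Measure.infinitePi fun _ : ℕ => m) (Measure.infinitePi fun _ : ℕ => m) :=
    ⟨(heval i).measurable.aemeasurable, (heval 0).measurable.aemeasurable,
      (heval i).map_eq.trans (heval 0).map_eq.symm⟩
  have hmean : ∫ x, f (x 0) ∂Measure.infinitePi (fun _ : ℕ => m) = ∫ a, f a ∂m := by
    have hmap := integral_map (μ := Measure.infinitePi fun _ : ℕ => m)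
      (heval 0).measurable.aemeasurable hf.aestronglyMeasurable
    rw [(heval 0).map_eq] at hmap
    exact hmap.symm
  have hlaw := ProbabilityTheory.strong_law_ae
    (μ := Measure.infinitePi fun _ : ℕ => m) (fun i (x : ℕ → X) => f (x i))
    ((heval 0).integrable_comp_of_integrable hint)
    (fun _ _ hij => hindep.indepFun hij) (fun i => (hident i).comp hf)
  simpa only [_root_.smul_eq_mul, hmean] using hlaw

/-- the strong law for a countable family.  For a probability space
`(X, Σ, m)` and a countable family `𝒜` of measurable sets, there is a sequence
`x : ℕ → X` whose frequencies `(1/n)·#{i < n : xᵢ ∈ A}` converge to `m A` for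
every `A ∈ 𝒜`. -/
theorem exists_seq_capturing_countable {X : Type*} [MeasurableSpace X]
    (m : Measure X) [IsProbabilityMeasure m]
    (𝒜 : Set (Set X)) (hmeas : ∀ A ∈ 𝒜, MeasurableSet A) (hcount : 𝒜.Countable) :
    ∃ x : ℕ → X, ∀ A ∈ 𝒜,
      Filter.Tendsto
        (fun n : ℕ => (n : ℝ)⁻¹ *
          ∑ i ∈ Finset.range n, A.indicator (fun _ => (1 : ℝ)) (x i))
        Filter.atTop (nhds (m A).toReal) := by
  have hae : ∀ᵐ x ∂Measure.infinitePi (fun _ : ℕ => m), ∀ A ∈ 𝒜,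
      Filter.Tendsto
        (fun n : ℕ => (n : ℝ)⁻¹ *
          ∑ i ∈ Finset.range n, A.indicator (fun _ => (1 : ℝ)) (x i))
        Filter.atTop (nhds (m A).toReal) := by
    refine (ae_ball_iff hcount).2 fun A hA => ?_
    have hlaw := ae_tendsto_average_infinitePi m
      (measurable_const.indicator (hmeas A hA) : Measurable (A.indicator fun _ => (1 : ℝ)))
      ((integrable_const 1).indicator (hmeas A hA))
    rwa [integral_indicator_const _ (hmeas A hA), _root_.smul_eq_mul, mul_one] at hlaw
  exact hae.exists
end
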